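/- arXiv:2411.16397 — 2 statements merged into one kernel-verified Lean document; each statement's English description precedes it below -/
import Mathlib

section
/- Let v be a valuation over a set X, let x ∈ V be a variable, and let t be a KA_{x̄,1̄} term. (i) For every nonempty word w ∈ X*, if w ∈ v̂(x) ∖ v̂(t), then ℓ ∈ v̂^⟨w⟩(x) ∖ v̂^⟨w⟩(t). (ii) For every word w ∈ X*, if ε ∈ v̂(x) ∖ v̂(t), then ε ∈ v̂^⟨w⟩(x) ∖ v̂^⟨w⟩(t). -/
/-- Terms of Kleene algebra with variable complements (`nvar`) and the
complemented identity constant (`cone`), over the countably infinite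
variable set `ℕ`. -/
inductive Term : Type where
  | var : ℕ → Term
  | nvar : ℕ → Term
  | zero : Term
  | one : Term
  | cone : Term
  | add : Term → Term → Term
  | comp : Term → Term → Term
  | star : Term → Term

/-- Composition (concatenation) of languages. -/
def cat {X : Type} (L M : Set (List X)) : Set (List X) :=
  {w | ∃ u ∈ L, ∃ v ∈ M, w = u ++ v}

/-- Kleene star of a language. -/
def kstar {X : Type} (L : Set (List X)) : Set (List X) :=
  {w | ∃ ws : List (List X), (∀ u ∈ ws, u ∈ L) ∧ w = ws.flatten}

/-- The interpretation `v̂(t)` of a term under a valuation `v : V → P(X*)`. -/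
def eval {X : Type} (v : ℕ → Set (List X)) : Term → Set (List X)
  | .var x => v x
  | .nvar x => (v x)ᶜ
  | .zero => ∅
  | .one => {[]}
  | .cone => ({[]} : Set (List X))ᶜ
  | .add t s => eval v t ∪ eval v s
  | .comp t s => cat (eval v t) (eval v s)
  | .star t => kstar (eval v t)

/-- The words-to-letters valuation `v^⟨w⟩` over the one-letter alphabet `{ℓ}`
(represented by `Unit`, with `ℓ = ()`):
`v^⟨w⟩(x) = {ε : ε ∈ v(x)} ∪ {ℓ : w ∈ v(x)}`. -/
def wl {X : Type} (v : ℕ → Set (List X)) (w : List X) : ℕ → Set (List Unit) :=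
  fun x => {u | (u = [] ∧ [] ∈ v x) ∨ (u = [()] ∧ w ∈ v x)}

theorem nil_mem_eval_of_wl {X : Type} (v : ℕ → Set (List X)) (w : List X) (t : Term)
    (h : [] ∈ eval (wl v w) t) : [] ∈ eval v t := by
  induction t with
  | var x => simpa [eval, wl] using h
  | nvar x => simpa [eval, wl] using h
  | zero => exact h
  | one => rfl
  | cone => exact absurd rfl h
  | add t s iht ihs => exact h.imp iht ihs
  | comp t s iht ihs =>
    obtain ⟨a, ha, b, hb, hab⟩ := h
    obtain ⟨rfl, rfl⟩ := List.append_eq_nil_iff.1 hab.symm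
    exact ⟨[], iht ha, [], ihs hb, rfl⟩
  | star t _ => exact ⟨[], by simp, rfl⟩

theorem mem_of_flatten_eq_singleton {α : Type} {a : α} {ws : List (List α)}
    (h : ws.flatten = [a]) : [a] ∈ ws := by
  induction ws with
  | nil => simp at h
  | cons u us ih =>
    rw [List.flatten_cons, List.append_eq_singleton_iff] at h
    rcases h with ⟨-, h⟩ | ⟨rfl, -⟩
    · exact List.mem_cons_of_mem _ (ih h)
    · exact List.mem_cons_self

theorem mem_eval_of_letter_mem_wl {X : Type} (v : ℕ → Set (List X)) {w : List X} (hw : w ≠ [])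
    (t : Term) (h : [()] ∈ eval (wl v w) t) : w ∈ eval v t := by
  induction t with
  | var x => simpa [eval, wl] using h
  | nvar x => simpa [eval, wl] using h
  | zero => exact h.elim
  | one => simp [eval] at h
  | cone => exact hw
  | add t s iht ihs => exact h.imp iht ihs
  | comp t s iht ihs =>
    obtain ⟨a, ha, b, hb, hab⟩ := h
    rcases List.append_eq_singleton_iff.1 hab.symm with ⟨rfl, rfl⟩ | ⟨rfl, rfl⟩
    · exact ⟨[], nil_mem_eval_of_wl v w t ha, w, ihs hb, rfl⟩
    · exact ⟨w, iht ha, [], nil_mem_eval_of_wl v w s hb, by simp⟩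
  | star t iht =>
    obtain ⟨ws, hws, hflat⟩ := h
    have hmem : w ∈ eval v t := iht (hws _ (mem_of_flatten_eq_singleton hflat.symm))
    exact ⟨[w], by simpa using hmem, by simp⟩

/-- (i) For every nonempty word `w`, if `w ∈ v̂(x) ∖ v̂(t)` then
`ℓ ∈ v̂^⟨w⟩(x) ∖ v̂^⟨w⟩(t)`; (ii) for every word `w`, if `ε ∈ v̂(x) ∖ v̂(t)`
then `ε ∈ v̂^⟨w⟩(x) ∖ v̂^⟨w⟩(t)`. -/
theorem stmt5 {X : Type} (v : ℕ → Set (List X)) (x : ℕ) (t : Term) :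
    (∀ w : List X, w ≠ [] → w ∈ eval v (.var x) \ eval v t →
      [()] ∈ eval (wl v w) (.var x) \ eval (wl v w) t) ∧
    (∀ w : List X, [] ∈ eval v (.var x) \ eval v t →
      [] ∈ eval (wl v w) (.var x) \ eval (wl v w) t) := by
  exact ⟨fun w hw h => ⟨Or.inr ⟨rfl, h.1⟩, fun ht => h.2 (mem_eval_of_letter_mem_wl v hw t ht)⟩,
    fun w h => ⟨Or.inl ⟨rfl, h.1⟩, fun ht => h.2 (nil_mem_eval_of_wl v w t ht)⟩⟩
end

section
/- Let u = x_0 ⋯ x_{n−1} be a word over the alphabet Ṽ_{1̄} (viewed as a KA_{x̄,1̄} term via composition) and let t be a KA_{x̄,1̄} term. The following are equivalent: (1) LANG ⊨ u ≤ t; (2) for every m ≤ n and every valuation v over the alphabet {ℓ_0, …, ℓ_{m−1}} such that v(x) is contained in the set of (contiguous) subwords of ℓ_0 ⋯ ℓ_{m−1} for every variable x, v̂(u) ⊆ v̂(t); (3) for every set X, every m ≤ n, every valuation v over X, and all nonempty words w_0, …, w_{m−1} ∈ X*, v̂^⟨w_0,…,w_{m−1}⟩(u) ⊆ v̂^⟨w_0,…,w_{m−1}⟩(t).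 -/
/-- The alphabet `Ṽ_{1̄} = {x, x̄ : x ∈ V} ∪ {1̄}`. -/
inductive TLetter : Type where
  | pos : ℕ → TLetter
  | neg : ℕ → TLetter
  | one : TLetter
  deriving DecidableEq

/-- A letter of `Ṽ_{1̄}` viewed as a term. -/
def TLetter.toTerm : TLetter → Term
  | .pos x => .var x
  | .neg x => .nvar x
  | .one => .cone

/-- A word over `Ṽ_{1̄}` viewed as a term (composition of its letters,
the empty word being `1`). -/
def wordToTerm : List TLetter → Term
  | [] => .one
  | a :: w => .comp a.toTerm (wordToTerm w)

/-- The regular language `⟦t⟧_{Ṽ1̄}` of `t` read as a regular expression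
over the alphabet `Ṽ_{1̄}`, where each of `x`, `x̄`, `1̄` is a single letter. -/
def syntacticLang : Term → Set (List TLetter)
  | .var x => {[.pos x]}
  | .nvar x => {[.neg x]}
  | .zero => ∅
  | .one => {[]}
  | .cone => {[.one]}
  | .add t s => syntacticLang t ∪ syntacticLang s
  | .comp t s => cat (syntacticLang t) (syntacticLang s)
  | .star t => kstar (syntacticLang t)

/-- The word `ℓ_i ℓ_{i+1} ⋯ ℓ_{j-1}` over the `n`-letter alphabet
`{ℓ_0, …, ℓ_{n-1}}` (represented by `Fin n`). -/
def seg (n i j : ℕ) : List (Fin n) :=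
  ((List.finRange n).drop i).take (j - i)

/-- The concatenation `w_i w_{i+1} ⋯ w_{j-1}` of the words `w_0, …, w_{n-1}`. -/
def catSeg {X : Type} {n : ℕ} (ws : Fin n → List X) (i j : ℕ) : List X :=
  (((List.ofFn ws).drop i).take (j - i)).flatten

/-- The words-to-letters valuation `v^⟨w_0, …, w_{n-1}⟩`, a valuation over the
`n`-letter alphabet `{ℓ_0, …, ℓ_{n-1}}` (represented by `Fin n`):
`v^⟨w_0,…,w_{n-1}⟩(x) = {ℓ_i ⋯ ℓ_{j-1} : 0 ≤ i ≤ j ≤ n ∧ w_i ⋯ w_{j-1} ∈ v(x)}`. -/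
def wls {X : Type} {n : ℕ} (v : ℕ → Set (List X)) (ws : Fin n → List X) :
    ℕ → Set (List (Fin n)) :=
  fun x => {u | ∃ i j : ℕ, i ≤ j ∧ j ≤ n ∧ u = seg n i j ∧ catSeg ws i j ∈ v x}

theorem seg_infix_finRange (m i j : ℕ) : seg m i j <:+: List.finRange m :=
  ((List.take_prefix _ _).isInfix).trans (List.drop_suffix _ _).isInfix

theorem seg_zero_self (m : ℕ) : seg m 0 m = List.finRange m := by
  simp [seg]

theorem exists_seg_of_infix {m : ℕ} {l : List (Fin m)} (h : l <:+: List.finRange m) :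
    ∃ i j, i ≤ j ∧ j ≤ m ∧ l = seg m i j := by
  obtain ⟨p, q, h⟩ := h
  have hlen := congrArg List.length h
  simp only [List.length_append, List.length_finRange] at hlen
  refine ⟨p.length, p.length + l.length, by omega, by omega, ?_⟩
  simp [seg, ← h]

theorem catSeg_eq_flatMap {X : Type} {m : ℕ} (ws : Fin m → List X) (i j : ℕ) :
    catSeg ws i j = (seg m i j).flatMap ws := by
  simp [catSeg, seg, List.ofFn_eq_map, List.flatMap_def, List.map_take, List.map_drop]

/-- On subwords of `ℓ_0 ⋯ ℓ_{m-1}`, membership in the words-to-letters valuation is membership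
of the substituted word in the original valuation. -/
theorem mem_wls_iff {X : Type} {m : ℕ} {v : ℕ → Set (List X)} {ws : Fin m → List X}
    {l : List (Fin m)} (hl : l <:+: List.finRange m) (x : ℕ) :
    l ∈ wls v ws x ↔ l.flatMap ws ∈ v x := by
  constructor
  · rintro ⟨i, j, -, -, rfl, h⟩
    rwa [← catSeg_eq_flatMap]
  · intro h
    obtain ⟨i, j, hij, hj, rfl⟩ := exists_seg_of_infix hl
    exact ⟨i, j, hij, hj, rfl, by rwa [catSeg_eq_flatMap]⟩

theorem flatMap_eq_nil_iff_of_ne_nil {X : Type} {m : ℕ} {ws : Fin m → List X}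
    (hws : ∀ k, ws k ≠ []) (l : List (Fin m)) : l.flatMap ws = [] ↔ l = [] := by
  cases l <;> simp [hws]

theorem mem_eval_wls_letter_iff {X : Type} {m : ℕ} {v : ℕ → Set (List X)} {ws : Fin m → List X}
    (hws : ∀ k, ws k ≠ []) {l : List (Fin m)} (hl : l <:+: List.finRange m) (a : TLetter) :
    l ∈ eval (wls v ws) a.toTerm ↔ l.flatMap ws ∈ eval v a.toTerm := by
  cases a with
  | pos x => exact mem_wls_iff hl x
  | neg x => exact not_congr (mem_wls_iff hl x)
  | one => exact not_congr (flatMap_eq_nil_iff_of_ne_nil hws l).symm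

/-- Substituting the nonempty words `w_i` for the letters `ℓ_i` maps the subwords of
`ℓ_0 ⋯ ℓ_{m-1}` in the interpretation of `t` into the original interpretation of `t`. -/
theorem flatMap_mem_eval {X : Type} {m : ℕ} {v : ℕ → Set (List X)} {ws : Fin m → List X}
    (hws : ∀ k, ws k ≠ []) (t : Term) {l : List (Fin m)} (hl : l <:+: List.finRange m)
    (h : l ∈ eval (wls v ws) t) : l.flatMap ws ∈ eval v t := by
  induction t generalizing l with
  | var x => exact (mem_eval_wls_letter_iff hws hl (.pos x)).1 h
  | nvar x => exact (mem_eval_wls_letter_iff hws hl (.neg x)).1 h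
  | cone => exact (mem_eval_wls_letter_iff hws hl .one).1 h
  | zero => exact h.elim
  | one => exact (flatMap_eq_nil_iff_of_ne_nil hws l).2 h
  | add t s iht ihs => exact h.imp (iht hl) (ihs hl)
  | comp t s iht ihs =>
    obtain ⟨a, ha, b, hb, rfl⟩ := h
    exact ⟨_, iht ((List.prefix_append a b).isInfix.trans hl) ha,
      _, ihs ((List.suffix_append a b).isInfix.trans hl) hb, List.flatMap_append⟩
  | star t iht =>
    obtain ⟨ls, hls, rfl⟩ := h
    refine ⟨ls.map (List.flatMap ws), ?_, ?_⟩
    · simp only [List.mem_map]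
      rintro _ ⟨a, ha, rfl⟩
      exact iht ((List.infix_of_mem_flatten ha).trans hl) (hls a ha)
    · simp [funext fun l => List.flatMap_def (f := ws) (l := l), List.map_flatten,
        List.flatten_flatten, Function.comp_def]

/-- A word in the interpretation of `u` splits into at most `|u|` nonempty words whose
words-to-letters valuation places the corresponding word of letters in the interpretation
of `u`. -/
theorem exists_nonempty_words {X : Type} (v : ℕ → Set (List X)) (u : List TLetter)
    {w : List X} (hw : w ∈ eval v (wordToTerm u)) :
    ∃ bs : List (List X), bs.length ≤ u.length ∧ (∀ b ∈ bs, b ≠ []) ∧ bs.flatten = w ∧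
      ∀ (m : ℕ) (ws : Fin m → List X), (∀ k, ws k ≠ []) → ∀ l : List (Fin m),
        l <:+: List.finRange m → l.map ws = bs → l ∈ eval (wls v ws) (wordToTerm u) := by
  induction u generalizing w with
  | nil =>
    refine ⟨[], le_rfl, by simp, Eq.symm hw, fun m ws _ l _ h => ?_⟩
    exact List.map_eq_nil_iff.1 h
  | cons a u ih =>
    obtain ⟨p, hp, q, hq, rfl⟩ := hw
    obtain ⟨bs, hlen, hne, rfl, hbs⟩ := ih hq
    obtain ⟨c, hc, hcne, rfl⟩ : ∃ c : List (List X),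
        c.length ≤ 1 ∧ (∀ b ∈ c, b ≠ []) ∧ c.flatten = p := by
      by_cases hp : p = []
      · exact ⟨[], by simp [hp]⟩
      · exact ⟨[p], by simp [hp]⟩
    refine ⟨c ++ bs, ?_, ?_, List.flatten_append, ?_⟩
    · simp only [List.length_append, List.length_cons]
      omega
    · intro b hb
      exact (List.mem_append.1 hb).elim (hcne b) (hne b)
    · intro m ws hws l hl h
      obtain ⟨l₁, l₂, rfl, rfl, h₂⟩ := List.map_eq_append_iff.1 h
      refine ⟨l₁, ?_, l₂, hbs m ws hws l₂ ((List.suffix_append l₁ l₂).isInfix.trans hl) h₂, rfl⟩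
      refine (mem_eval_wls_letter_iff hws ((List.prefix_append l₁ l₂).isInfix.trans hl) a).2 ?_
      rwa [List.flatMap_def]

/-- For a word `u` over `Ṽ_{1̄}` (of length `n`) and a `KA_{x̄,1̄}` term `t`,
the following are equivalent: (1) `LANG ⊨ u ≤ t`; (2) for every `m ≤ n` and
every valuation over `{ℓ_0, …, ℓ_{m-1}}` whose values consist of contiguous
subwords of `ℓ_0 ⋯ ℓ_{m-1}`, `v̂(u) ⊆ v̂(t)`; (3) for every words-to-letters
valuation `v^⟨w_0,…,w_{m-1}⟩` with `m ≤ n` and nonempty `w_0, …, w_{m-1}`,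
`v̂^⟨w_0,…,w_{m-1}⟩(u) ⊆ v̂^⟨w_0,…,w_{m-1}⟩(t)`. -/
theorem stmt9 (u : List TLetter) (t : Term) :
    List.TFAE
      [∀ (X : Type) (v : ℕ → Set (List X)),
         eval v (wordToTerm u) ⊆ eval v t,
       ∀ m : ℕ, m ≤ u.length → ∀ v : ℕ → Set (List (Fin m)),
         (∀ x : ℕ, v x ⊆ {w | w <:+: seg m 0 m}) →
         eval v (wordToTerm u) ⊆ eval v t,
       ∀ (X : Type) (m : ℕ), m ≤ u.length →
         ∀ (v : ℕ → Set (List X)) (ws : Fin m → List X), (∀ k, ws k ≠ []) →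
         eval (wls v ws) (wordToTerm u) ⊆ eval (wls v ws) t] := by
  tfae_have 1 → 2 := fun h m _ v _ => h (Fin m) v
  tfae_have 2 → 3 := by
    intro h X m hm v ws _
    refine h m hm _ fun x => ?_
    rintro _ ⟨i, j, -, -, rfl, -⟩
    rw [seg_zero_self]
    exact seg_infix_finRange m i j
  tfae_have 3 → 1 := by
    intro h X v w hw
    obtain ⟨bs, hlen, hne, rfl, hbs⟩ := exists_nonempty_words v u hw
    have hws : ∀ k, bs.get k ≠ [] := fun k => hne _ (bs.get_mem k)
    have hmap : (List.finRange bs.length).map bs.get = bs := List.map_get_finRange bs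
    have := flatMap_mem_eval hws t List.infix_rfl
      (h X _ hlen v bs.get hws (hbs _ bs.get hws _ List.infix_rfl hmap))
    rwa [List.flatMap_def, hmap] at this
  tfae_finish
end
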